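/- Let X be a finite-dimensional real normed space, let 𝒢 be a closed subgroup of the isometry group of X, and let f : X → ℝ be 𝒢-invariant (f(g·x) = f(x) for all g ∈ 𝒢, x ∈ X). Suppose f is twice differentiable at x₀ with df(x₀) = 0, the Hessian d²f(x₀) is positive semi-definite, and d²f(x₀)(u,u) = 0 exactly when u lies in the tangent space T of the orbit 𝒢·x₀ at x₀. Then x₀ is a local minimum of f, and there is a neighbourhood U of x₀ with f⁻¹(f(x₀)) ∩ U = (𝒢·x₀) ∩ U. -/

import Mathlib

open Filter Asymptotics

/-- A tangent direction of an orbit under a group of isometries of a finite-dimensional normed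
space is approximated by multiples with a factor at least `1` of displacements within the orbit. -/
theorem exists_one_le_smul_near_of_mem_tangentConeAt_orbit {X : Type*} [NormedAddCommGroup X]
    [NormedSpace ℝ X] [FiniteDimensional ℝ X] (𝒢 : Subgroup (X ≃ᵢ X)) (x₀ v : X)
    (hv : v ∈ tangentConeAt ℝ ((fun g : X ≃ᵢ X => g x₀) '' (𝒢 : Set (X ≃ᵢ X))) x₀)
    {δ : ℝ} (hδ : 0 < δ) :
    ∃ c : ℝ, 1 ≤ c ∧ ∃ g ∈ 𝒢, ‖c • (g x₀ - x₀) - v‖ < δ := by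
  obtain ⟨c, d, hc, hd, hcd⟩ := mem_tangentConeAt_iff_exists_seq_norm_tendsto_atTop.1 hv
  have hd0 := tangentConeAt.lim_zero atTop hc hcd
  have hmem : ∀ᶠ n in atTop, ∃ g ∈ 𝒢, g x₀ = x₀ + d n := hd
  obtain ⟨N₀, hN₀⟩ := eventually_atTop.1 hmem
  choose! g hg𝒢 hg using hN₀
  let L : ℕ → X →L[ℝ] X := fun n =>
    ((g n).toRealLinearIsometryEquiv.toContinuousLinearEquiv : X →L[ℝ] X)
  have hL : ∀ n x y, L n (x - y) = g n x - g n y := by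
    intro n x y
    rw [map_sub]
    simp [L]
  have hLball : ∀ n, L n ∈ Metric.closedBall (0 : X →L[ℝ] X) 1 := by
    intro n
    rw [mem_closedBall_zero_iff]
    refine ContinuousLinearMap.opNorm_le_bound _ zero_le_one fun x => ?_
    rw [one_mul]
    exact ((g n).toRealLinearIsometryEquiv.norm_map x).le
  obtain ⟨A, -, φ, hφ, hA⟩ := (isCompact_closedBall (0 : X →L[ℝ] X) 1).tendsto_subseq hLball
  have hφt := hφ.tendsto_atTop
  have hε : 0 < δ / (3 * (‖v‖ + δ)) := by positivity
  obtain ⟨N₁, hN₁⟩ := Metric.cauchySeq_iff.1 hA.cauchySeq _ hε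
  obtain ⟨m, hm₁, hm₀, hcm, hdm⟩ : ∃ m, N₁ ≤ m ∧ N₀ ≤ φ m ∧ 1 ≤ ‖c (φ m)‖ ∧
      ‖c (φ m) • d (φ m) - v‖ < δ / 3 := by
    have h₁ := (hc.comp hφt).eventually_ge_atTop 1
    have h₂ := Metric.tendsto_nhds.1 (hcd.comp hφt) (δ / 3) (by positivity)
    obtain ⟨m, h⟩ := ((eventually_ge_atTop N₁).and
      ((hφt.eventually_ge_atTop N₀).and (h₁.and h₂))).exists
    exact ⟨m, h.1, h.2.1, h.2.2.1, by simpa [dist_eq_norm] using h.2.2.2⟩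
  rcases le_total 0 (c (φ m)) with hpos | hneg
  · refine ⟨c (φ m), by rwa [Real.norm_of_nonneg hpos] at hcm, g (φ m), hg𝒢 _ hm₀, ?_⟩
    rw [hg _ hm₀, add_sub_cancel_left]
    linarith
  · obtain ⟨n, hn₁, hn₀, hdn⟩ : ∃ n, N₁ ≤ n ∧ N₀ ≤ φ n ∧ ‖c (φ m) • d (φ n)‖ < δ / 3 := by
      have h₂ : Tendsto (fun n => c (φ m) • d (φ n)) atTop (nhds 0) := by
        simpa using (hd0.comp hφt).const_smul (c (φ m))
      have h₃ := Metric.tendsto_nhds.1 h₂ (δ / 3) (by positivity)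
      obtain ⟨n, h⟩ := ((eventually_ge_atTop N₁).and
        ((hφt.eventually_ge_atTop N₀).and h₃)).exists
      exact ⟨n, h.1, h.2.1, by simpa using h.2.2⟩
    refine ⟨-c (φ m), by rwa [Real.norm_of_nonpos hneg] at hcm, g (φ n) * (g (φ m))⁻¹,
      𝒢.mul_mem (hg𝒢 _ hn₀) (𝒢.inv_mem (hg𝒢 _ hm₀)), ?_⟩
    set y : X := (g (φ m))⁻¹ x₀ with hy
    have hgy : g (φ m) y = x₀ := IsometryEquiv.apply_inv_self _ _
    have hLm : L (φ m) (x₀ - y) = d (φ m) := by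
      rw [hL, hgy, hg _ hm₀, add_sub_cancel_left]
    have hLn : g (φ n) y - x₀ = d (φ n) - L (φ n) (x₀ - y) := by
      rw [hL, hg _ hn₀]; abel
    have hnorm : ‖x₀ - y‖ = ‖d (φ m)‖ := by
      rw [← hLm]
      exact ((g (φ m)).toRealLinearIsometryEquiv.norm_map _).symm
    have hkey : -c (φ m) • (g (φ n) y - x₀) - v
        = (c (φ m) • d (φ m) - v) - c (φ m) • d (φ n)
          + c (φ m) • (L (φ n) - L (φ m)) (x₀ - y) := by
      rw [hLn, sub_apply, hLm]
      module
    have hsmall : ‖c (φ m) • (L (φ n) - L (φ m)) (x₀ - y)‖ ≤ δ / 3 := by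
      have h₁ : ‖L (φ n) - L (φ m)‖ ≤ δ / (3 * (‖v‖ + δ)) := by
        rw [← dist_eq_norm]
        exact (hN₁ n hn₁ m hm₁).le
      have h₂ : ‖c (φ m) • d (φ m)‖ ≤ ‖v‖ + δ := by
        have := norm_sub_norm_le (c (φ m) • d (φ m)) v
        linarith
      calc ‖c (φ m) • (L (φ n) - L (φ m)) (x₀ - y)‖
          ≤ ‖c (φ m)‖ * (‖L (φ n) - L (φ m)‖ * ‖x₀ - y‖) := by
            rw [norm_smul]
            gcongr
            exact ContinuousLinearMap.le_opNorm _ _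
        _ = ‖L (φ n) - L (φ m)‖ * ‖c (φ m) • d (φ m)‖ := by
            rw [hnorm, norm_smul]; ring
        _ ≤ δ / (3 * (‖v‖ + δ)) * (‖v‖ + δ) := by gcongr
        _ = δ / 3 := by field_simp
    have hmul : (g (φ n) * (g (φ m))⁻¹) x₀ = g (φ n) y := rfl
    rw [hmul, hkey]
    refine (norm_add_le _ _).trans_lt ?_
    have := norm_sub_le (c (φ m) • d (φ m) - v) (c (φ m) • d (φ n))
    linarith

/-- If `x₀` is a nearest point to `x₀ + h` in its orbit, then `0` is a nearest point to `h` in the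
tangent cone of the orbit at `x₀`. -/
theorem norm_le_norm_sub_of_mem_tangentConeAt_orbit {X : Type*} [NormedAddCommGroup X]
    [NormedSpace ℝ X] [FiniteDimensional ℝ X] (𝒢 : Subgroup (X ≃ᵢ X)) (x₀ v h : X)
    (hv : v ∈ tangentConeAt ℝ ((fun g : X ≃ᵢ X => g x₀) '' (𝒢 : Set (X ≃ᵢ X))) x₀)
    (hh : ∀ g ∈ 𝒢, ‖h‖ ≤ ‖x₀ + h - g x₀‖) : ‖h‖ ≤ ‖h - v‖ := by
  by_contra! hlt
  obtain ⟨c, hc, g, hg, hcg⟩ :=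
    exists_one_le_smul_near_of_mem_tangentConeAt_orbit 𝒢 x₀ v hv (sub_pos.2 hlt)
  set d := g x₀ - x₀ with hd
  have h₁ : ‖h - c • d‖ < ‖h‖ := by
    have := norm_sub_le (h - v) (c • d - v)
    rw [sub_sub_sub_cancel_right] at this
    linarith
  have h₂ : ‖h‖ ≤ ‖h - d‖ := by
    convert hh g hg using 2
    rw [hd]; abel
  have h₃ : c • (h - d) = (c - 1) • h + (h - c • d) := by module
  have h₄ : c * ‖h - d‖ ≤ (c - 1) * ‖h‖ + ‖h - c • d‖ := by
    have := norm_add_le ((c - 1) • h) (h - c • d)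
    rwa [← h₃, norm_smul, norm_smul, Real.norm_of_nonneg (by linarith),
      Real.norm_of_nonneg (by linarith)] at this
  nlinarith

/-- A quadratic form that is positive off a subspace `T` is coercive on the vectors to which `0`
is a nearest point of `T`. -/
theorem exists_pos_forall_mul_sq_norm_le {X : Type*} [NormedAddCommGroup X]
    [NormedSpace ℝ X] [FiniteDimensional ℝ X] (H : X →L[ℝ] X →L[ℝ] ℝ) (T : Submodule ℝ X)
    (hH : ∀ u : X, u ∉ T → 0 < H u u) :
    ∃ c : ℝ, 0 < c ∧ ∀ h : X, (∀ v ∈ T, ‖h‖ ≤ ‖h - v‖) → c * ‖h‖ ^ 2 ≤ H h h := by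
  let K : Set X := Metric.sphere 0 1 ∩ ⋂ v ∈ T, {u | 1 ≤ ‖u - v‖}
  have hK : IsCompact K := (isCompact_sphere 0 1).inter_right <|
    isClosed_biInter fun v _ => isClosed_le continuous_const (by fun_prop)
  have hpos : ∀ u ∈ K, 0 < H u u := by
    intro u hu
    refine hH u fun huT => ?_
    have := Set.mem_iInter₂.1 hu.2 u huT
    norm_num at this
  obtain ⟨c, hc, hcK⟩ : ∃ c : ℝ, 0 < c ∧ ∀ u ∈ K, c ≤ H u u :=
    hK.exists_forall_le' (by fun_prop) hpos
  refine ⟨c, hc, fun h hh => ?_⟩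
  rcases eq_or_ne h 0 with rfl | h0
  · simp
  have hn : 0 < ‖h‖ := norm_pos_iff.2 h0
  have hu : ‖h‖⁻¹ • h ∈ K := by
    refine ⟨by simp [norm_smul, hn.ne'], Set.mem_iInter₂.2 fun v hv => ?_⟩
    have h₁ := hh (‖h‖ • v) (T.smul_mem _ hv)
    have h₂ : h - ‖h‖ • v = ‖h‖ • (‖h‖⁻¹ • h - v) := by
      rw [smul_sub, smul_inv_smul₀ hn.ne']
    rw [h₂, norm_smul, norm_norm] at h₁
    exact le_of_mul_le_mul_left (by simpa using h₁) hn
  have h₃ := hcK _ hu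
  simp only [map_smul, smul_apply, smul_eq_mul] at h₃
  calc c * ‖h‖ ^ 2 ≤ ‖h‖⁻¹ * (‖h‖⁻¹ * H h h) * ‖h‖ ^ 2 := by gcongr
    _ = H h h := by field_simp

/-- Let `X` be a finite-dimensional real normed space, `𝒢` a subgroup of the isometry group
of `X` whose orbit `𝒢·x₀` is closed, and `f : X → ℝ` a `𝒢`-invariant function. If `f` is
twice differentiable at `x₀` with zero derivative, positive semi-definite Hessian `H`, and
`H(u,u) = 0` exactly for `u` in the tangent space `T` of the orbit `𝒢·x₀` at `x₀`, then
`x₀` is a local minimum of `f` and there is a neighbourhood `U` of `x₀` with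
`f⁻¹(f x₀) ∩ U = (𝒢·x₀) ∩ U`. -/
theorem stmt4 {X : Type*} [NormedAddCommGroup X] [NormedSpace ℝ X] [FiniteDimensional ℝ X]
    (𝒢 : Subgroup (X ≃ᵢ X)) (f : X → ℝ) (x₀ : X)
    (hinv : ∀ g ∈ 𝒢, ∀ x : X, f (g x) = f x)
    (horbit_closed : IsClosed ((fun g : X ≃ᵢ X => g x₀) '' (𝒢 : Set (X ≃ᵢ X))))
    (df : X →L[ℝ] ℝ) (H : X →L[ℝ] X →L[ℝ] ℝ)
    (hsymm : ∀ u v : X, H u v = H v u)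
    (htaylor : (fun h : X => f (x₀ + h) - f x₀ - df h - (1 / 2) * H h h)
      =o[nhds 0] fun h : X => ‖h‖ ^ 2)
    (hdf : df = 0)
    (hpsd : ∀ u : X, 0 ≤ H u u)
    (T : Submodule ℝ X)
    (hT : (T : Set X) =
      tangentConeAt ℝ ((fun g : X ≃ᵢ X => g x₀) '' (𝒢 : Set (X ≃ᵢ X))) x₀)
    (hzero : ∀ u : X, H u u = 0 ↔ u ∈ T) :
    IsLocalMin f x₀ ∧ ∃ U ∈ nhds x₀,
      {x : X | f x = f x₀} ∩ U =
        ((fun g : X ≃ᵢ X => g x₀) '' (𝒢 : Set (X ≃ᵢ X))) ∩ U := by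
  set S := (fun g : X ≃ᵢ X => g x₀) '' (𝒢 : Set (X ≃ᵢ X)) with hS
  have hx₀S : x₀ ∈ S := ⟨1, 𝒢.one_mem, rfl⟩
  obtain ⟨c, hc, hcoer⟩ := exists_pos_forall_mul_sq_norm_le H T fun u hu =>
    (hpsd u).lt_of_ne fun h => hu ((hzero u).1 h.symm)
  obtain ⟨δ, hδ, hball⟩ := Metric.eventually_nhds_iff_ball.1
    (htaylor.bound (show 0 < c / 4 by positivity))
  have hmain : ∀ x ∈ Metric.ball x₀ δ, f x₀ ≤ f x ∧ (f x = f x₀ → x ∈ S) := by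
    intro x hx
    obtain ⟨_, ⟨g, hg, rfl⟩, hdist⟩ := horbit_closed.exists_infDist_eq_dist ⟨x₀, hx₀S⟩ x
    have hmin : ∀ k ∈ 𝒢, dist x (g x₀) ≤ dist x (k x₀) := fun k hk =>
      hdist ▸ Metric.infDist_le_dist_of_mem ⟨k, hk, rfl⟩
    obtain ⟨h, rfl⟩ : ∃ h, g (x₀ + h) = x := ⟨g.symm x - x₀, by simp⟩
    have hnorm : dist (g (x₀ + h)) (g x₀) = ‖h‖ := by
      rw [g.dist_eq, dist_self_add_left]
    have hnear : ∀ k ∈ 𝒢, ‖h‖ ≤ ‖x₀ + h - k x₀‖ := by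
      intro k hk
      have := hmin (g * k) (𝒢.mul_mem hg hk)
      rw [hnorm] at this
      rwa [← dist_eq_norm, ← g.dist_eq]
    have hhδ : ‖h‖ < δ := by
      have := hmin 1 𝒢.one_mem
      rw [hnorm] at this
      exact this.trans_lt hx
    have hHh : c * ‖h‖ ^ 2 ≤ H h h := hcoer h fun v hv =>
      norm_le_norm_sub_of_mem_tangentConeAt_orbit 𝒢 x₀ v h (hT ▸ hv) hnear
    have hb := (abs_le.1 (hball h (by simpa using hhδ))).1
    simp only [hdf, zero_apply, sub_zero, norm_pow, norm_norm] at hb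
    rw [hinv g hg]
    have hgrow : c / 4 * ‖h‖ ^ 2 ≤ f (x₀ + h) - f x₀ := by linarith
    refine ⟨by nlinarith [sq_nonneg ‖h‖], fun heq => ?_⟩
    have h0 : h = 0 := by
      by_contra hne
      have : 0 < c / 4 * ‖h‖ ^ 2 := by positivity
      linarith
    exact ⟨g, hg, by simp [h0]⟩
  refine ⟨?_, Metric.ball x₀ δ, Metric.ball_mem_nhds _ hδ, ?_⟩
  · filter_upwards [Metric.ball_mem_nhds x₀ hδ] with x hx using (hmain x hx).1
  · ext x
    refine and_congr_left fun hx => ⟨(hmain x hx).2, ?_⟩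
    rintro ⟨g, hg, rfl⟩
    exact hinv g hg x₀
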